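/- arXiv:1912.01253 — 2 statements merged into one kernel-verified Lean document; each statement's English description precedes it below -/
import Mathlib

section
/- Let n ≥ 1 and let b ∈ ℝ^n satisfy 0 < b_1 < b_2 < … < b_n, and set a = 0 ∈ ℝ^n. Define the pseudovertices p_0 = 0 and, for j = 1, …, n, p_j = (b_1, …, b_{j-1}, b_j, b_j, …, b_j) (the k-th coordinate of p_j is b_k for k < j and b_j for k ≥ j). Then (1) the points p_0, p_1, …, p_n are affinely independent, and (2) the ordinary convex hull of tconv({a, b}) equals the set of all x ∈ ℝ^n satisfying: b_1 − x_1 ≥ 0; for each j = 1, …, n−1, −(b_{j+1} − b_j) x_{j-1} + (b_{j+1} − b_{j-1}) x_j − (b_j − b_{j-1}) x_{j+1} ≥ 0 (with the conventions x_0 := 0 and b_0 := 0); and −x_{n-1} + x_n ≥ 0 (with the convention x_0 := 0 when n = 1). -/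
/-- A set `U ⊆ ℝ^n` is tropically convex (min-plus convention). -/
def TropConvex {n : ℕ} (U : Set (Fin n → ℝ)) : Prop :=
  ∀ x ∈ U, ∀ y ∈ U, ∀ a b : ℝ, min a b = 0 →
    (fun i => min (a + x i) (b + y i)) ∈ U

/-- The tropical convex hull: the intersection of all tropically convex sets containing `U`. -/
def tconv {n : ℕ} (U : Set (Fin n → ℝ)) : Set (Fin n → ℝ) :=
  ⋂₀ {V | TropConvex V ∧ U ⊆ V}

/-- 1-indexed coordinate access with the convention `x_0 := 0` (and `0` out of range). -/
noncomputable def coordExt {n : ℕ} (x : Fin n → ℝ) (k : ℕ) : ℝ :=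
  if h : 1 ≤ k ∧ k ≤ n then x ⟨k - 1, by omega⟩ else 0

theorem coordExt_zero {n : ℕ} (x : Fin n → ℝ) : coordExt x 0 = 0 := by
  simp [coordExt]

theorem coordExt_succ {n : ℕ} (x : Fin n → ℝ) (k : Fin n) :
    coordExt x ((k : ℕ) + 1) = x k := by
  simp [coordExt]

theorem coordExt_add {n : ℕ} (x y : Fin n → ℝ) (k : ℕ) :
    coordExt (x + y) k = coordExt x k + coordExt y k := by
  unfold coordExt
  split_ifs <;> simp

theorem coordExt_smul {n : ℕ} (c : ℝ) (x : Fin n → ℝ) (k : ℕ) :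
    coordExt (c • x) k = c * coordExt x k := by
  unfold coordExt
  split_ifs <;> simp

theorem coordExt_min {n : ℕ} (b : Fin n → ℝ) {s : ℝ} (hs : 0 ≤ s) (k : ℕ) :
    coordExt (fun i => min s (b i)) k = min s (coordExt b k) := by
  unfold coordExt
  split_ifs with h
  · rfl
  · simp [hs]

theorem strictMonoOn_coordExt {n : ℕ} {b : Fin n → ℝ} (hpos : ∀ i, 0 < b i)
    (hb : StrictMono b) : StrictMonoOn (coordExt b) (Set.Iic n) := by
  intro i hi j hj hij
  simp only [Set.mem_Iic] at hi hj
  obtain ⟨j, rfl⟩ : ∃ j' : ℕ, j = j' + 1 := ⟨j - 1, by omega⟩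
  rw [coordExt_succ b ⟨j, hj⟩]
  rcases i with _ | i
  · rw [coordExt_zero]
    exact hpos _
  · rw [coordExt_succ b ⟨i, hi⟩]
    exact hb (Fin.mk_lt_mk.2 (by omega))

/-- The tropical segment from the origin to a positive point. -/
theorem tconv_zero_pair {n : ℕ} {b : Fin n → ℝ} (hpos : ∀ i, 0 < b i) :
    tconv {(0 : Fin n → ℝ), b} = {x | ∃ s : ℝ, 0 ≤ s ∧ x = fun i => min s (b i)} := by
  apply Set.Subset.antisymm
  · refine Set.sInter_subset_of_mem ⟨?_, ?_⟩
    · rintro _ ⟨s, hs, rfl⟩ _ ⟨t, ht, rfl⟩ c d hcd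
      have hc : 0 ≤ c := hcd ▸ min_le_left c d
      have hd : 0 ≤ d := hcd ▸ min_le_right c d
      refine ⟨min (c + s) (d + t), le_min (by linarith) (by linarith), ?_⟩
      funext i
      calc min (c + min s (b i)) (d + min t (b i))
          = min (min (c + s) (d + t)) (min (c + b i) (d + b i)) := by
            rw [← min_add_add_left, ← min_add_add_left, min_min_min_comm]
        _ = min (min (c + s) (d + t)) (b i) := by
            rw [min_add_add_right, hcd, zero_add]
    · rintro x (rfl | rfl)
      · exact ⟨0, le_rfl, funext fun i => by simp [(hpos i).le]⟩
      · refine ⟨∑ i, x i, Finset.sum_nonneg fun i _ => (hpos i).le, funext fun i => ?_⟩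
        exact (min_eq_right
          (Finset.single_le_sum (fun j _ => (hpos j).le) (Finset.mem_univ i))).symm
  · rintro _ ⟨s, hs, rfl⟩ V ⟨hV, hsub⟩
    simpa using hV 0 (hsub (by simp)) b (hsub (by simp)) s 0 (min_eq_right hs)

/-- Truncation at a fixed level is concave along increasing nodes. -/
theorem truncation_second_difference_nonneg {u v w : ℝ} (huv : u < v) (hvw : v < w) (s : ℝ) :
    0 ≤ -(w - v) * min s u + (w - u) * min s v - (v - u) * min s w := by
  rcases le_total s u with h1 | h1 <;> rcases le_total s v with h2 | h2 <;>
    rcases le_total s w with h3 | h3 <;> simp only [min_eq_left, min_eq_right, h1, h2, h3] <;>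
    nlinarith [mul_nonneg (sub_nonneg.2 huv.le) (sub_nonneg.2 hvw.le)]

/-- Summation by parts against truncated nodes reconstructs a function from its slopes. -/
theorem sum_slope_drop_mul_min {n : ℕ} {B X s : ℕ → ℝ} (hB : StrictMonoOn B (Set.Iic n))
    (hB0 : B 0 = 0) (hX0 : X 0 = 0)
    (hs : ∀ k < n, s (k + 1) * (B (k + 1) - B k) = X (k + 1) - X k)
    {m : ℕ} (hm : m ≤ n) {N : ℕ} (hN : N ≤ n) :
    ∑ j ∈ Finset.range (N + 1), (s j - s (j + 1)) * min (B j) (B m)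
      = X (min N m) - s (N + 1) * min (B N) (B m) := by
  have hmono := hB.monotoneOn
  induction N with
  | zero =>
    have : (0 : ℝ) ≤ B m := hB0 ▸ hmono (Set.mem_Iic.2 hN) (Set.mem_Iic.2 hm) (Nat.zero_le m)
    simp [hB0, hX0, this]
  | succ N ih =>
    rw [Finset.sum_range_succ, ih (by omega)]
    have hN' : N ∈ Set.Iic n := Set.mem_Iic.2 (by omega)
    rcases lt_or_ge N m with h | h
    · rw [min_eq_left (hmono hN' hm h.le), min_eq_left (hmono hN hm h), min_eq_left h.le,
        min_eq_left (Nat.succ_le_of_lt h)]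
      linear_combination hs N (by omega)
    · rw [min_eq_right (hmono hm hN' h), min_eq_right (hmono hm hN (by omega)),
        min_eq_right h, min_eq_right (by omega : m ≤ N + 1)]
      ring

/-- Weights orthogonal to all truncations of increasing nodes, and of total zero, vanish. -/
theorem weights_eq_zero_of_sum_min_eq_zero {n : ℕ} {B : ℕ → ℝ}
    (hB : StrictMonoOn B (Set.Iic n)) {w : Fin (n + 1) → ℝ} (hw : ∑ j, w j = 0)
    (h : ∀ m ≤ n, ∑ j : Fin (n + 1), w j * min (B j) (B m) = 0) : w = 0 := by
  have hmono := hB.monotoneOn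
  have tail : ∀ m ≤ n + 1, ∑ j : Fin (n + 1), (if m ≤ (j : ℕ) then w j else 0) = 0 := by
    rintro (_ | m) hm
    · simpa using hw
    rcases Nat.lt_or_ge n (m + 1) with hnm | hmn
    · refine Finset.sum_eq_zero fun j _ => if_neg ?_
      have := j.2
      omega
    · have hm1 : m ∈ Set.Iic n := Set.mem_Iic.2 (by omega)
      have hgap : B (m + 1) - B m ≠ 0 :=
        (sub_pos.2 (hB hm1 hmn (Nat.lt_succ_self m))).ne'
      refine (mul_eq_zero.1 ?_).resolve_left hgap
      have hdiff := congrArg₂ (· - ·) (h (m + 1) hmn) (h m (by omega))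
      simp only [sub_self, ← Finset.sum_sub_distrib] at hdiff
      rw [Finset.mul_sum]
      refine (Finset.sum_congr rfl fun j _ => ?_).trans hdiff
      have hj : (j : ℕ) ∈ Set.Iic n := Set.mem_Iic.2 (by omega)
      split_ifs with hmj
      · rw [min_eq_right (hmono hmn hj hmj), min_eq_right (hmono hm1 hj (by omega))]
        ring
      · rw [min_eq_left (hmono hj hmn (by omega)), min_eq_left (hmono hj hm1 (by omega))]
        ring
  funext i
  have hi := tail i (by omega)
  have hi' := tail (i + 1) (by omega)
  have key : ∑ j : Fin (n + 1), ((if (i : ℕ) ≤ (j : ℕ) then w j else 0)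
      - (if (i : ℕ) + 1 ≤ (j : ℕ) then w j else 0)) = w i := by
    rw [Finset.sum_eq_single i]
    · simp
    · intro j _ hj
      have : (j : ℕ) ≠ i := fun hji => hj (Fin.ext hji)
      split_ifs <;> first | omega | simp
    · simp
  rw [Finset.sum_sub_distrib, hi, hi'] at key
  simpa using key.symm

/-- The polyhedron of points whose slopes along the nodes `0, b₁, …, bₙ` decrease from at most
`1` to at least `0`. -/
def slopePolyhedron {n : ℕ} (b : Fin n → ℝ) : Set (Fin n → ℝ) :=
  {x : Fin n → ℝ |
    coordExt b 1 - coordExt x 1 ≥ 0 ∧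
    (∀ j : ℕ, 1 ≤ j → j ≤ n - 1 →
      -(coordExt b (j + 1) - coordExt b j) * coordExt x (j - 1)
        + (coordExt b (j + 1) - coordExt b (j - 1)) * coordExt x j
        - (coordExt b j - coordExt b (j - 1)) * coordExt x (j + 1) ≥ 0) ∧
    -coordExt x (n - 1) + coordExt x n ≥ 0}

theorem convex_slopePolyhedron {n : ℕ} (b : Fin n → ℝ) : Convex ℝ (slopePolyhedron b) := by
  rintro x ⟨hx1, hx2, hx3⟩ y ⟨hy1, hy2, hy3⟩ c d hc hd hcd
  refine ⟨?_, fun j hj hjn => ?_, ?_⟩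
  · rw [coordExt_add, coordExt_smul, coordExt_smul]
    have := add_nonneg (mul_nonneg hc hx1) (mul_nonneg hd hy1)
    linear_combination this + coordExt b 1 * hcd
  · simp only [coordExt_add, coordExt_smul]
    have := add_nonneg (mul_nonneg hc (hx2 j hj hjn)) (mul_nonneg hd (hy2 j hj hjn))
    linear_combination this
  · simp only [coordExt_add, coordExt_smul]
    have := add_nonneg (mul_nonneg hc hx3) (mul_nonneg hd hy3)
    linear_combination this

theorem truncation_mem_slopePolyhedron {n : ℕ} (hn : 1 ≤ n) {b : Fin n → ℝ}
    (hB : StrictMonoOn (coordExt b) (Set.Iic n)) {s : ℝ} (hs : 0 ≤ s) :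
    (fun i => min s (b i)) ∈ slopePolyhedron b := by
  refine ⟨?_, fun j hj hjn => ?_, ?_⟩
  · rw [coordExt_min b hs]
    exact sub_nonneg.2 (min_le_right _ _)
  · simp only [coordExt_min b hs]
    refine truncation_second_difference_nonneg (hB ?_ ?_ ?_) (hB ?_ ?_ ?_) s <;>
      first | omega | (simp only [Set.mem_Iic]; omega)
  · simp only [coordExt_min b hs]
    have := hB.monotoneOn (Set.mem_Iic.2 (by omega : n - 1 ≤ n)) (Set.mem_Iic.2 le_rfl)
      (by omega)
    linarith [min_le_min_left s this]

/-- The points of the slope polyhedron are convex combinations of the truncations of `b`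
at its own coordinates. -/
theorem exists_weights_of_mem_slopePolyhedron {n : ℕ} (hn : 1 ≤ n) {b : Fin n → ℝ}
    (hB : StrictMonoOn (coordExt b) (Set.Iic n)) {x : Fin n → ℝ} (hx : x ∈ slopePolyhedron b) :
    ∃ w : ℕ → ℝ, (∀ j ≤ n, 0 ≤ w j) ∧ ∑ j ∈ Finset.range (n + 1), w j = 1 ∧
      ∀ k : Fin n, ∑ j ∈ Finset.range (n + 1), w j * min (coordExt b j) (b k) = x k := by
  obtain ⟨hx1, hx2, hx3⟩ := hx
  have hgap : ∀ k < n, 0 < coordExt b (k + 1) - coordExt b k := fun k hk =>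
    sub_pos.2 (hB (Set.mem_Iic.2 hk.le) (Set.mem_Iic.2 hk) (Nat.lt_succ_self k))
  let s : ℕ → ℝ := fun k => if k = 0 then 1 else if k = n + 1 then 0 else
    (coordExt x k - coordExt x (k - 1)) / (coordExt b k - coordExt b (k - 1))
  have hs0 : s 0 = 1 := by simp [s]
  have hsn : s (n + 1) = 0 := by simp [s]
  have hss : ∀ k < n, s (k + 1)
      = (coordExt x (k + 1) - coordExt x k) / (coordExt b (k + 1) - coordExt b k) := by
    intro k hk
    simp [s, hk.ne]
  refine ⟨fun j => s j - s (j + 1), fun j hj => sub_nonneg.2 ?_, ?_, fun k => ?_⟩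
  · rcases j with _ | j
    · rw [hs0, hss 0 hn, div_le_one (hgap 0 hn)]
      simp only [coordExt_zero, zero_add]
      linarith
    · rw [hss j hj]
      rcases Nat.lt_or_ge (j + 1) n with hjn | hjn
      · rw [hss (j + 1) hjn, div_le_div_iff₀ (hgap _ hjn) (hgap _ hj)]
        have := hx2 (j + 1) (by omega) (by omega)
        rw [Nat.add_sub_cancel] at this
        linear_combination this
      · obtain rfl : n = j + 1 := by omega
        rw [hsn]
        rw [Nat.add_sub_cancel] at hx3
        exact div_nonneg (by linarith) (hgap j hj).le
  · rw [Finset.sum_range_sub', hs0, hsn, sub_zero]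
  · have := sum_slope_drop_mul_min (X := coordExt x) (s := s) hB (coordExt_zero b)
      (coordExt_zero x) (fun k hk => by rw [hss k hk, div_mul_cancel₀ _ (hgap k hk).ne'])
      (m := k + 1) k.2 le_rfl
    rw [hsn, min_eq_right (Nat.succ_le_of_lt k.2), zero_mul, sub_zero, coordExt_succ,
      coordExt_succ] at this
    exact this

theorem convexHull_tconv_zero_pair {n : ℕ} (hn : 1 ≤ n) {b : Fin n → ℝ} (hpos : ∀ i, 0 < b i)
    (hb : StrictMono b) : convexHull ℝ (tconv {(0 : Fin n → ℝ), b}) = slopePolyhedron b := by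
  have hB := strictMonoOn_coordExt hpos hb
  rw [tconv_zero_pair hpos]
  apply Set.Subset.antisymm
  · refine convexHull_min ?_ (convex_slopePolyhedron b)
    rintro _ ⟨s, hs, rfl⟩
    exact truncation_mem_slopePolyhedron hn hB hs
  · intro x hx
    obtain ⟨w, hw0, hw1, hwx⟩ := exists_weights_of_mem_slopePolyhedron hn hB hx
    have hmem : ∑ j ∈ Finset.range (n + 1), w j • (fun k => min (coordExt b j) (b k)) ∈
        convexHull ℝ {x : Fin n → ℝ | ∃ s : ℝ, 0 ≤ s ∧ x = fun i => min s (b i)} := by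
      refine (convex_convexHull ℝ _).sum_mem (fun j hj => hw0 j ?_) hw1 fun j hj => ?_
      · exact Nat.lt_succ_iff.1 (Finset.mem_range.1 hj)
      · refine subset_convexHull ℝ _ ⟨coordExt b j, ?_, rfl⟩
        rw [← coordExt_zero b]
        exact hB.monotoneOn (Set.mem_Iic.2 (Nat.zero_le n))
          (Set.mem_Iic.2 (Nat.lt_succ_iff.1 (Finset.mem_range.1 hj))) (Nat.zero_le j)
    convert hmem using 1
    funext k
    simp [Finset.sum_apply, hwx k]

theorem affineIndependent_truncations {n : ℕ} {b : Fin n → ℝ} (hpos : ∀ i, 0 < b i)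
    (hb : StrictMono b) :
    AffineIndependent ℝ fun (j : Fin (n + 1)) (k : Fin n) => min (coordExt b j) (b k) := by
  have hB := strictMonoOn_coordExt hpos hb
  rw [affineIndependent_iff_of_fintype]
  intro w hw hsum
  rw [Finset.univ.weightedVSub_eq_linear_combination hw] at hsum
  refine congrFun (weights_eq_zero_of_sum_min_eq_zero hB hw fun m hm => ?_)
  rcases m with _ | m
  · refine Finset.sum_eq_zero fun j _ => ?_
    rw [min_eq_right (hB.monotoneOn (Set.mem_Iic.2 (Nat.zero_le n))
      (Set.mem_Iic.2 (Nat.lt_succ_iff.1 j.2)) (Nat.zero_le _)), coordExt_zero, mul_zero]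
  · have := congrFun hsum ⟨m, hm⟩
    simpa [Finset.sum_apply, coordExt_succ b ⟨m, hm⟩] using this

theorem pseudovertices_and_H_representation (n : ℕ) (hn : 1 ≤ n) (b : Fin n → ℝ)
    (hb0 : 0 < b ⟨0, hn⟩) (hbmono : StrictMono b)
    (p : Fin (n + 1) → Fin n → ℝ)
    (hp0 : p 0 = 0)
    (hpsucc : ∀ j k : Fin n, p j.succ k = if (k : ℕ) < (j : ℕ) then b k else b j) :
    AffineIndependent ℝ p ∧
    convexHull ℝ (tconv {(0 : Fin n → ℝ), b}) =
      {x : Fin n → ℝ |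
        coordExt b 1 - coordExt x 1 ≥ 0 ∧
        (∀ j : ℕ, 1 ≤ j → j ≤ n - 1 →
          -(coordExt b (j + 1) - coordExt b j) * coordExt x (j - 1)
            + (coordExt b (j + 1) - coordExt b (j - 1)) * coordExt x j
            - (coordExt b j - coordExt b (j - 1)) * coordExt x (j + 1) ≥ 0) ∧
        -coordExt x (n - 1) + coordExt x n ≥ 0} := by
  have hpos : ∀ i, 0 < b i := fun i =>
    hb0.trans_le (hbmono.monotone (Fin.mk_le_of_le_val (Nat.zero_le _)))
  refine ⟨?_, convexHull_tconv_zero_pair hn hpos hbmono⟩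
  convert affineIndependent_truncations hpos hbmono using 1
  funext j k
  induction j using Fin.cases with
  | zero => simp [hp0, coordExt_zero, (hpos k).le]
  | succ j =>
    rw [hpsucc, Fin.val_succ, coordExt_succ]
    split_ifs with h
    · exact (min_eq_right (hbmono.monotone (Fin.le_def.2 h.le))).symm
    · exact (min_eq_left (hbmono.monotone (Fin.le_def.2 (not_lt.1 h)))).symm
end

section
/- For every subset U of ℝ², tconv(convexHull(U)) = convexHull(tconv(U)); i.e., ordinary convex hull and tropical convex hull commute in dimension two. -/
/-- The point `z` satisfies the sector criterion for `C`: each of the three closed min-plus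
sectors with apex `z` contains a point of `C`. -/
def MeetsSectors (C : Set (Fin 2 → ℝ)) (z : Fin 2 → ℝ) : Prop :=
  (∃ u ∈ C, z 0 ≤ u 0 ∧ z 1 ≤ u 1) ∧
  (∃ u ∈ C, u 0 ≤ z 0 ∧ u 0 - z 0 ≤ u 1 - z 1) ∧
  (∃ u ∈ C, u 1 ≤ z 1 ∧ u 1 - z 1 ≤ u 0 - z 0)

theorem subset_tconv {n : ℕ} (U : Set (Fin n → ℝ)) : U ⊆ tconv U :=
  Set.subset_sInter fun _ hV => hV.2

theorem tconv_subset {n : ℕ} {U V : Set (Fin n → ℝ)} (hV : TropConvex V) (h : U ⊆ V) :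
    tconv U ⊆ V :=
  Set.sInter_subset_of_mem ⟨hV, h⟩

theorem tropConvex_tconv {n : ℕ} (U : Set (Fin n → ℝ)) : TropConvex (tconv U) :=
  fun x hx y hy a b hab V hV => hV.1 x (hx V hV) y (hy V hV) a b hab

theorem tconv_mono {n : ℕ} {U V : Set (Fin n → ℝ)} (h : U ⊆ V) : tconv U ⊆ tconv V :=
  tconv_subset (tropConvex_tconv V) (h.trans (subset_tconv V))

theorem meetsSectors_of_mem {C : Set (Fin 2 → ℝ)} {z : Fin 2 → ℝ} (hz : z ∈ C) :
    MeetsSectors C z :=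
  ⟨⟨z, hz, le_rfl, le_rfl⟩, ⟨z, hz, le_rfl, by simp⟩, ⟨z, hz, le_rfl, by simp⟩⟩

theorem tropConvex_setOf_meetsSectors (C : Set (Fin 2 → ℝ)) :
    TropConvex {z | MeetsSectors C z} := by
  rintro x ⟨⟨p, hp, hp0, hp1⟩, ⟨q, hq, hq0, hq1⟩, ⟨r, hr, hr0, hr1⟩⟩
    y ⟨⟨p', hp', hp0', hp1'⟩, ⟨q', hq', hq0', hq1'⟩, ⟨r', hr', hr0', hr1'⟩⟩ a b hab
  have ha : 0 ≤ a := hab ▸ min_le_left a b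
  have hb : 0 ≤ b := hab ▸ min_le_right a b
  have hl : ∀ i, min (a + x i) (b + y i) ≤ a + x i := fun i => min_le_left _ _
  have hle : ∀ i, min (a + x i) (b + y i) ≤ b + y i := fun i => min_le_right _ _
  refine ⟨?_, ?_, ?_⟩
  · rcases min_choice a b with h | h
    · exact ⟨p, hp, by linarith [hl 0], by linarith [hl 1]⟩
    · exact ⟨p', hp', by linarith [hle 0], by linarith [hle 1]⟩
  · rcases min_choice (a + x 0) (b + y 0) with h | h
    · exact ⟨q, hq, by linarith, by linarith [hl 1]⟩
    · exact ⟨q', hq', by linarith, by linarith [hle 1]⟩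
  · rcases min_choice (a + x 1) (b + y 1) with h | h
    · exact ⟨r, hr, by linarith, by linarith [hl 0]⟩
    · exact ⟨r', hr', by linarith, by linarith [hle 0]⟩

theorem TropConvex.mem_of_meetsSectors {T : Set (Fin 2 → ℝ)} (hT : TropConvex T)
    {z : Fin 2 → ℝ} (hz : MeetsSectors T z) : z ∈ T := by
  obtain ⟨⟨p, hp, hp0, hp1⟩, ⟨q, hq, hq0, hq1⟩, ⟨r, hr, hr0, hr1⟩⟩ := hz
  have h := hT _ (hT p hp q hq 0 (z 0 - q 0) (min_eq_left (by linarith))) r hr 0 (z 1 - r 1)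
    (min_eq_left (by linarith))
  convert h using 1
  ext i
  fin_cases i
  · simp only [Fin.zero_eta]
    rw [min_eq_right (a := 0 + p 0) (by linarith), min_eq_left (by linarith)]
    ring
  · simp only [Fin.mk_one]
    rw [min_eq_right]
    · ring
    · exact (le_min (by linarith) (by linarith)).trans_eq (zero_add _).symm

theorem mem_tconv_iff_meetsSectors {C : Set (Fin 2 → ℝ)} {z : Fin 2 → ℝ} :
    z ∈ tconv C ↔ MeetsSectors C z := by
  refine ⟨fun h => tconv_subset (tropConvex_setOf_meetsSectors C)
    (fun _ => meetsSectors_of_mem) h, fun h => (tropConvex_tconv C).mem_of_meetsSectors ?_⟩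
  obtain ⟨⟨p, hp, hp'⟩, ⟨q, hq, hq'⟩, ⟨r, hr, hr'⟩⟩ := h
  exact ⟨⟨p, subset_tconv C hp, hp'⟩, ⟨q, subset_tconv C hq, hq'⟩, ⟨r, subset_tconv C hr, hr'⟩⟩

/-- The tropical convex hull of a convex set is convex. -/
theorem convex_tconv {C : Set (Fin 2 → ℝ)} (hC : Convex ℝ C) : Convex ℝ (tconv C) := by
  intro x hx y hy s t hs ht hst
  rw [mem_tconv_iff_meetsSectors] at hx hy ⊢
  obtain ⟨⟨p, hp, hp0, hp1⟩, ⟨q, hq, hq0, hq1⟩, ⟨r, hr, hr0, hr1⟩⟩ := hx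
  obtain ⟨⟨p', hp', hp0', hp1'⟩, ⟨q', hq', hq0', hq1'⟩, ⟨r', hr', hr0', hr1'⟩⟩ := hy
  refine ⟨⟨_, hC hp hp' hs ht hst, ?_, ?_⟩, ⟨_, hC hq hq' hs ht hst, ?_, ?_⟩,
    ⟨_, hC hr hr' hs ht hst, ?_, ?_⟩⟩ <;>
  simp only [Pi.add_apply, Pi.smul_apply, smul_eq_mul] <;>
  nlinarith

theorem exists_le_of_mem_convexHull {E : Type*} [AddCommGroup E] [Module ℝ E] {s : Set E} {p : E}
    (hp : p ∈ convexHull ℝ s) (f : E →ₗ[ℝ] ℝ) {c : ℝ} (hc : c ≤ f p) : ∃ v ∈ s, c ≤ f v := by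
  by_contra! h
  have : p ∈ {w | f w < c} :=
    convexHull_min (fun v hv => h v hv) (convex_halfSpace_lt f.isLinear c) hp
  exact absurd hc (not_le.mpr this)

/-- Let `f, g` span the dual space, and let `S` be the cone `0 ≤ f, 0 ≤ g` with apex `z`.
If `convexHull ℝ T` meets `S` and `T` contains a point on the ray `f = g ≤ 0` from `z` as soon as
it has points on both sides of `S`, then `z ∈ convexHull ℝ T` or `T` itself meets `S`. -/
theorem mem_convexHull_or_exists_mem_sector {E : Type*} [NormedAddCommGroup E] [NormedSpace ℝ E]
    {T : Set E} {z p : E} (f g : E →ₗ[ℝ] ℝ)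
    (hspan : ∀ l : E →L[ℝ] ℝ, ∃ α β : ℝ, ∀ w, l w = α * f w + β * g w)
    (hp : p ∈ convexHull ℝ T) (hpf : f z ≤ f p) (hpg : g z ≤ g p)
    (hray : ∀ u ∈ T, ∀ v ∈ T, f z ≤ f u → g u < g z → g z ≤ g v → f v < f z →
      ∃ d ∈ T, f d - f z = g d - g z ∧ f d ≤ f z) :
    z ∈ convexHull ℝ T ∨ ∃ u ∈ T, f z ≤ f u ∧ g z ≤ g u := by
  by_contra! ⟨hz, hT⟩
  rw [convexHull_eq_union_convexHull_finite_subsets] at hp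
  simp only [Set.mem_iUnion] at hp
  obtain ⟨t, htT, hpt⟩ := hp
  obtain ⟨u, hut, hu⟩ := exists_le_of_mem_convexHull hpt f hpf
  obtain ⟨v, hvt, hv⟩ := exists_le_of_mem_convexHull hpt g hpg
  have hu' := hT u (htT hut) hu
  have hv' : f v < f z := by
    by_contra! h
    exact absurd hv (not_le.mpr (hT v (htT hvt) h))
  obtain ⟨d, hdT, hd, hdz⟩ := hray u (htT hut) v (htT hvt) hu hu' hv hv'
  have hd' : f d < f z := by
    by_contra! h
    linarith [hT d hdT h]
  have hsub : insert d (t : Set E) ⊆ T := Set.insert_subset hdT htT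
  have hclosed : IsClosed (convexHull ℝ (insert d (t : Set E))) :=
    (t.finite_toSet.insert d).isClosed_convexHull ℝ
  obtain ⟨l, c, hlz, hl⟩ := geometric_hahn_banach_point_closed (convex_convexHull ℝ _) hclosed
    (fun h => hz (convexHull_mono hsub h))
  obtain ⟨α, β, hαβ⟩ := hspan l
  have hpos : ∀ w ∈ convexHull ℝ (insert d (t : Set E)),
      0 < α * (f w - f z) + β * (g w - g z) := by
    intro w hw
    have h1 := hl w hw
    rw [hαβ] at h1 hlz
    linarith
  have hmem : ∀ w ∈ t, w ∈ convexHull ℝ (insert d (t : Set E)) := fun w hw =>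
    subset_convexHull ℝ _ (Set.mem_insert_of_mem d hw)
  have hpd := hpos d (subset_convexHull ℝ _ (Set.mem_insert d _))
  have hpp := hpos p (convexHull_mono (Set.subset_insert d _) hpt)
  have hpu := hpos u (hmem u hut)
  have hpv := hpos v (hmem v hvt)
  have hsum : α + β < 0 := by
    rw [← hd] at hpd
    nlinarith
  rcases le_or_gt α 0 with hα | hα
  · rcases le_or_gt β 0 with hβ | hβ <;> nlinarith
  · nlinarith

/-- The convex hull of a tropically convex set in the plane is tropically convex. -/
theorem tropConvex_convexHull {T : Set (Fin 2 → ℝ)} (hT : TropConvex T) :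
    TropConvex (convexHull ℝ T) := by
  intro x hx y hy a b hab
  have hz := tropConvex_setOf_meetsSectors _ x (meetsSectors_of_mem hx) y
    (meetsSectors_of_mem hy) a b hab
  generalize (fun i => min (a + x i) (b + y i)) = z at hz ⊢
  obtain ⟨⟨p, hp, hp0, hp1⟩, ⟨q, hq, hq0, hq1⟩, ⟨r, hr, hr0, hr1⟩⟩ := hz
  let e : Fin 2 → (Fin 2 → ℝ) →ₗ[ℝ] ℝ := fun i => LinearMap.proj i
  have hdual : ∀ l : (Fin 2 → ℝ) →L[ℝ] ℝ, ∃ α β : ℝ, ∀ w, l w = α * w 0 + β * w 1 := by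
    intro l
    refine ⟨l (Pi.single 0 1), l (Pi.single 1 1), fun w => ?_⟩
    have hw : w = w 0 • Pi.single 0 1 + w 1 • Pi.single 1 1 := by
      ext i
      fin_cases i <;> simp
    conv_lhs => rw [hw]
    simp only [map_add, map_smul, smul_eq_mul]
    ring
  rcases mem_convexHull_or_exists_mem_sector (z := z) (e 0) (e 1)
    hdual hp hp0 hp1 (by
      intro u hu v hv hu0 hu1 hv1 hv0
      simp only [e, LinearMap.proj_apply] at *
      let m := min (z 0 - v 0) (z 1 - u 1)
      have hm : 0 ≤ m := le_min (by linarith) (by linarith)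
      have hm0 : m ≤ z 0 - v 0 := min_le_left _ _
      have hm1 : m ≤ z 1 - u 1 := min_le_right _ _
      have h := hT v hv u hu (z 0 - v 0 - m) (z 1 - u 1 - m) (by
        rw [min_sub_sub_right]
        exact sub_self m)
      refine ⟨_, h, ?_, ?_⟩
      · rw [min_eq_left (by linarith), min_eq_right (by linarith)]
        ring
      · rw [min_eq_left (by linarith)]
        linarith) with h | ⟨u, hu, hu0, hu1⟩
  · exact h
  rcases mem_convexHull_or_exists_mem_sector (z := z) (-e 0) (e 1 - e 0)
    (fun l => by
      obtain ⟨α, β, h⟩ := hdual l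
      refine ⟨-(α + β), β, fun w => ?_⟩
      simp only [h, e, LinearMap.proj_apply, LinearMap.neg_apply, LinearMap.sub_apply]
      ring) hq (by simpa [e] using hq0)
    (by simp only [e, LinearMap.proj_apply, LinearMap.sub_apply]; linarith) (by
      intro u hu v hv hu0 hu1 hv1 hv0
      simp only [e, LinearMap.proj_apply, LinearMap.neg_apply, LinearMap.sub_apply] at *
      refine ⟨_, hT v hv u hu 0 (z 1 - u 1) (min_eq_left (by linarith)), ?_, ?_⟩
      · rw [min_eq_right (a := 0 + v 1) (by linarith)]
        ring
      · exact neg_le_neg (le_min (by linarith) (by linarith)))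
    with h | ⟨v, hv, hv0, hv1⟩
  · exact h
  rcases mem_convexHull_or_exists_mem_sector (z := z) (-e 1) (e 0 - e 1)
    (fun l => by
      obtain ⟨α, β, h⟩ := hdual l
      refine ⟨-(α + β), α, fun w => ?_⟩
      simp only [h, e, LinearMap.proj_apply, LinearMap.neg_apply, LinearMap.sub_apply]
      ring) hr (by simpa [e] using hr0)
    (by simp only [e, LinearMap.proj_apply, LinearMap.sub_apply]; linarith) (by
      intro u hu v hv hu0 hu1 hv1 hv0
      simp only [e, LinearMap.proj_apply, LinearMap.neg_apply, LinearMap.sub_apply] at *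
      refine ⟨_, hT v hv u hu 0 (z 0 - u 0) (min_eq_left (by linarith)), ?_, ?_⟩
      · rw [min_eq_right (a := 0 + v 0) (by linarith)]
        ring
      · exact neg_le_neg (le_min (by linarith) (by linarith)))
    with h | ⟨w, hw, hw0, hw1⟩
  · exact h
  simp only [e, LinearMap.proj_apply, LinearMap.neg_apply, LinearMap.sub_apply] at *
  exact subset_convexHull ℝ T (hT.mem_of_meetsSectors ⟨⟨u, hu, hu0, hu1⟩,
    ⟨v, hv, by linarith, by linarith⟩, ⟨w, hw, by linarith, by linarith⟩⟩)

theorem tconv_convexHull_comm_R2 (U : Set (Fin 2 → ℝ)) :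
    tconv (convexHull ℝ U) = convexHull ℝ (tconv U) := by
  apply Set.Subset.antisymm
  · exact tconv_subset (tropConvex_convexHull (tropConvex_tconv U)) (convexHull_mono (subset_tconv U))
  · exact convexHull_min (tconv_mono (subset_convexHull ℝ U)) (convex_tconv (convex_convexHull ℝ U))
end
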